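/- For every n ≥ 3 and every vertex v of the cycle C_n, the position of the Normal Domination Game on C_n in which v is the only selected vertex has Grundy value (n−3) % 4 (it is equivalent to the position P''_{n−3}). -/

import Mathlib

open SimpleGraph Finset

/-- A vertex `u` is dominated by the selected set `S` if it lies in the closed
neighborhood of some selected vertex. -/
def Dominated {V : Type} (G : SimpleGraph V) (S : Finset V) (u : V) : Prop :=
  ∃ s ∈ S, u = s ∨ G.Adj s u

/-- A vertex `v` is playable in position `S` if some vertex of the closed
neighborhood of `v` is not dominated by `S`. -/
def Playable {V : Type} (G : SimpleGraph V) (S : Finset V) (v : V) : Prop :=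
  ∃ u, (u = v ∨ G.Adj v u) ∧ ¬ Dominated G S u

lemma Playable.not_mem {V : Type} {G : SimpleGraph V} {S : Finset V} {v : V}
    (h : Playable G S v) : v ∉ S := by
  intro hv
  obtain ⟨u, hu, hnd⟩ := h
  exact hnd ⟨v, hv, hu.imp id (fun a => a)⟩

lemma Playable.card_lt {V : Type} [Fintype V] [DecidableEq V]
    {G : SimpleGraph V} {S : Finset V} {v : V} (h : Playable G S v) :
    (Finset.univ \ insert v S).card < (Finset.univ \ S).card := by
  apply Finset.card_lt_card
  refine ⟨Finset.sdiff_subset_sdiff (le_refl _) (Finset.subset_insert v S), ?_⟩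
  intro hsub
  have hv : v ∈ Finset.univ \ S := by simp [h.not_mem]
  have := hsub hv
  simp at this

/-- The Grundy value (nimber) of a position of the Normal Domination Game:
the minimum excludant (least natural number not attained) of the Grundy values
of the positions reachable in one move (i.e. by selecting a playable vertex). -/
noncomputable def grundy {V : Type} [Fintype V] [DecidableEq V]
    (G : SimpleGraph V) (S : Finset V) : ℕ :=
  sInf {m : ℕ |
    m ∉ Set.range fun v : {v : V // Playable G S v} => grundy G (insert v.1 S)}
termination_by (Finset.univ \ S).card
decreasing_by exact v.2.card_lt

/-- A value attained by no option, all of whose predecessors are attained, is the Grundy value. -/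
lemma grundy_eq_of_options {V : Type} [Fintype V] [DecidableEq V] {G : SimpleGraph V}
    {S : Finset V} {m : ℕ} (hne : ∀ v, Playable G S v → grundy G (insert v S) ≠ m)
    (hlt : ∀ k < m, ∃ v, Playable G S v ∧ grundy G (insert v S) = k) : grundy G S = m := by
  rw [grundy]
  apply IsLeast.csInf_eq
  refine ⟨?_, ?_⟩
  · rintro ⟨⟨v, hv⟩, h⟩
    exact hne v hv h
  · intro k hk
    by_contra! hkm
    obtain ⟨v, hv, h⟩ := hlt k hkm
    exact hk ⟨⟨v, hv⟩, h⟩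

/-- The nim-sum of a family of natural numbers over a finite set. -/
def nimSum {V : Type} (S : Finset V) (f : V → ℕ) : ℕ :=
  S.fold (· ^^^ ·) 0 f

lemma nimSum_insert {V : Type} [DecidableEq V] {S : Finset V} {v : V} (hv : v ∉ S) (f : V → ℕ) :
    nimSum (insert v S) f = f v ^^^ nimSum S f :=
  Finset.fold_insert hv

lemma nimSum_congr {V : Type} {S : Finset V} {f g : V → ℕ} (h : ∀ t ∈ S, f t = g t) :
    nimSum S f = nimSum S g :=
  Finset.fold_congr h

lemma nimSum_eq_xor_erase {V : Type} [DecidableEq V] {S : Finset V} {v : V} (hv : v ∈ S)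
    (f : V → ℕ) : nimSum S f = f v ^^^ nimSum (S.erase v) f := by
  rw [← nimSum_insert (Finset.notMem_erase v S), Finset.insert_erase hv]

/-- The winning move in nim: every smaller value is attained by lowering a single summand. -/
lemma exists_lt_of_lt_nimSum {V : Type} [DecidableEq V] (f : V → ℕ) :
    ∀ (S : Finset V) (k : ℕ), k < nimSum S f →
      ∃ s ∈ S, k ^^^ nimSum (S.erase s) f < f s := by
  intro S
  induction S using Finset.induction_on with
  | empty => intro k hk; simp [nimSum] at hk
  | insert v S hv ih =>
    intro k hk
    rw [nimSum_insert hv] at hk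
    rcases Nat.lt_xor_cases hk with h | h
    · exact ⟨v, Finset.mem_insert_self v S, by rwa [Finset.erase_insert hv]⟩
    · obtain ⟨s, hs, hlt⟩ := ih _ h
      have hvs : v ≠ s := fun e => hv (e ▸ hs)
      refine ⟨s, Finset.mem_insert_of_mem hs, ?_⟩
      rw [Finset.erase_insert_of_ne hvs,
        nimSum_insert (fun h => hv (Finset.mem_of_mem_erase h)), ← Nat.xor_assoc]
      exact hlt

/-- The Grundy value of a stretch between consecutive selected vertices at distance `d`. -/
def gapValue (d : ℕ) : ℕ :=
  if d < 3 then 0 else (d + 1) % 4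

lemma gapValue_xor_ne {a b : ℕ} (ha : 0 < a) (hb : 0 < b) (hab : 4 ≤ a + b) :
    gapValue a ^^^ gapValue b ≠ gapValue (a + b) := by
  unfold gapValue
  rw [if_neg (by omega : ¬ a + b < 3)]
  split_ifs with h₁ h₂ h₂
  · rw [Nat.xor_zero]; omega
  · rw [Nat.zero_xor]; omega
  · rw [Nat.xor_zero]; omega
  · intro h
    have hpar := congrArg (· % 2) h
    simp only [Nat.xor_mod_two_eq] at hpar
    omega

lemma exists_split_of_lt_gapValue {d k : ℕ} (hk : k < gapValue d) :
    ∃ i, 0 < i ∧ i < d ∧ 4 ≤ d ∧ gapValue i ^^^ gapValue (d - i) = k := by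
  have hd : ¬ d < 3 := by
    intro h
    simp [gapValue, h] at hk
  simp only [gapValue, if_neg hd] at hk
  refine ⟨(d + 1) % 4 - k, by omega, by omega, by omega, ?_⟩
  have h0 : gapValue ((d + 1) % 4 - k) = 0 := by
    unfold gapValue
    split_ifs <;> omega
  rw [h0, Nat.zero_xor]
  unfold gapValue
  split_ifs <;> omega

section Cycle

variable {N : ℕ}

/-- The cyclic distance from `s` to the next element of `S`. -/
noncomputable def gap (S : Finset (Fin (N + 2))) (s : Fin (N + 2)) : ℕ :=
  sInf {k : ℕ | 0 < k ∧ s + k • 1 ∈ S}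

lemma val_nsmul_one (k : ℕ) : (k • (1 : Fin (N + 2))).val = k % (N + 2) := by
  induction k with
  | zero => simp
  | succ k ih => rw [succ_nsmul, Fin.val_add, ih]; simp

lemma exists_add_nsmul_one (s t : Fin (N + 2)) : ∃ k : ℕ, 0 < k ∧ s + k • 1 = t := by
  refine ⟨(t - s).val + (N + 2), by omega, ?_⟩
  have h : ((t - s).val + (N + 2)) • (1 : Fin (N + 2)) = t - s := by
    ext
    rw [val_nsmul_one, Nat.add_mod_right, Nat.mod_eq_of_lt (t - s).isLt]
  rw [h, add_sub_cancel]

lemma gap_spec {S : Finset (Fin (N + 2))} {s : Fin (N + 2)} (hs : s ∈ S) :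
    0 < gap S s ∧ s + gap S s • 1 ∈ S := by
  have hne : {k : ℕ | 0 < k ∧ s + k • 1 ∈ S}.Nonempty := by
    obtain ⟨k, hk, h⟩ := exists_add_nsmul_one s s
    exact ⟨k, hk, by rwa [h]⟩
  exact Nat.sInf_mem hne

lemma notMem_of_lt_gap {S : Finset (Fin (N + 2))} {s : Fin (N + 2)} {j : ℕ} (hj : 0 < j)
    (hlt : j < gap S s) : s + j • 1 ∉ S :=
  fun h => Nat.notMem_of_lt_sInf hlt ⟨hj, h⟩

lemma gap_eq {S : Finset (Fin (N + 2))} {s : Fin (N + 2)} {k : ℕ} (hk : 0 < k)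
    (hmem : s + k • 1 ∈ S) (hmin : ∀ j, 0 < j → j < k → s + j • 1 ∉ S) : gap S s = k := by
  apply IsLeast.csInf_eq
  refine ⟨⟨hk, hmem⟩, fun j hj => ?_⟩
  by_contra! hlt
  exact hmin j hj.1 hlt hj.2

lemma exists_mem_gap {S : Finset (Fin (N + 2))} (hS : S.Nonempty) {v : Fin (N + 2)}
    (hv : v ∉ S) : ∃ s ∈ S, ∃ i, 0 < i ∧ i < gap S s ∧ v = s + i • 1 := by
  have hex : ∃ i : ℕ, 0 < i ∧ v - i • 1 ∈ S := by
    obtain ⟨t, ht⟩ := hS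
    obtain ⟨k, hk, h⟩ := exists_add_nsmul_one t v
    exact ⟨k, hk, by rwa [← h, add_sub_cancel_right]⟩
  classical
  obtain ⟨hi, hmem⟩ := Nat.find_spec hex
  have hmin := fun j => Nat.find_min hex (m := j)
  generalize Nat.find hex = i at hi hmem hmin
  refine ⟨_, hmem, i, hi, ?_, by abel⟩
  by_contra! hle
  obtain ⟨hpos, hg⟩ := gap_spec hmem
  generalize gap S (v - i • 1) = d at hle hpos hg
  obtain ⟨e, rfl⟩ := Nat.exists_eq_add_of_le hle
  have he : v - (d + e) • 1 + d • 1 = v - e • 1 := by rw [add_nsmul]; abel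
  rw [he] at hg
  rcases Nat.eq_zero_or_pos e with rfl | hpos'
  · exact hv (by simpa using hg)
  · exact hmin e (by omega) ⟨hpos', hg⟩

lemma add_nsmul_one_ne {S : Finset (Fin (N + 2))} {s t : Fin (N + 2)} (ht : t ∈ S) {i j : ℕ}
    (hij : i < j) (hj : j - i < gap S s) : s + j • 1 ≠ t + i • 1 := by
  intro h
  obtain ⟨e, rfl⟩ := Nat.exists_eq_add_of_lt hij
  have he : s + (e + 1) • 1 = t := by
    rw [show i + e + 1 = (e + 1) + i by ring, add_nsmul _ (e + 1) i, ← add_assoc] at h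
    exact add_right_cancel h
  exact notMem_of_lt_gap (by omega) (by omega) (he ▸ ht)

lemma gap_insert_left {S : Finset (Fin (N + 2))} {s : Fin (N + 2)} (hs : s ∈ S) {i : ℕ}
    (hi : 0 < i) (hlt : i < gap S s) : gap (insert (s + i • 1) S) s = i := by
  refine gap_eq hi (Finset.mem_insert_self _ _) fun j hj hji h => ?_
  rcases Finset.mem_insert.1 h with h | h
  · exact add_nsmul_one_ne hs hji (by omega) h.symm
  · exact notMem_of_lt_gap hj (by omega) h

lemma gap_insert_self {S : Finset (Fin (N + 2))} {s : Fin (N + 2)} (hs : s ∈ S) {i : ℕ}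
    (hlt : i < gap S s) :
    gap (insert (s + i • 1) S) (s + i • 1) = gap S s - i := by
  refine gap_eq (by omega) ?_ fun j hj hji h => ?_
  · rw [add_assoc, ← add_nsmul, Nat.add_sub_cancel' hlt.le]
    exact Finset.mem_insert_of_mem (gap_spec hs).2
  · rw [add_assoc, ← add_nsmul] at h
    rcases Finset.mem_insert.1 h with h | h
    · exact add_nsmul_one_ne hs (by omega) (by omega) h
    · exact notMem_of_lt_gap (by omega) (by omega) h

lemma gap_insert_of_ne {S : Finset (Fin (N + 2))} {s t : Fin (N + 2)} (hs : s ∈ S) (ht : t ∈ S)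
    (hts : t ≠ s) {i : ℕ} (hlt : i < gap S s) :
    gap (insert (s + i • 1) S) t = gap S t := by
  refine gap_eq (gap_spec ht).1 (Finset.mem_insert_of_mem (gap_spec ht).2) fun j hj hjg h => ?_
  rcases Finset.mem_insert.1 h with h | h
  · rcases lt_trichotomy i j with hij | rfl | hij
    · exact add_nsmul_one_ne hs hij (by omega) h
    · exact hts (add_right_cancel h)
    · exact add_nsmul_one_ne ht hij (by omega) h.symm
  · exact notMem_of_lt_gap hj hjg h

lemma dominated_cycleGraph {S : Finset (Fin (N + 2))} {u : Fin (N + 2)} :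
    Dominated (cycleGraph (N + 2)) S u ↔ u ∈ S ∨ u + 1 ∈ S ∨ u - 1 ∈ S := by
  simp only [Dominated, cycleGraph_adj]
  constructor
  · rintro ⟨t, ht, rfl | h | h⟩
    · exact Or.inl ht
    · exact Or.inr (Or.inl (by rwa [← h, add_sub_cancel]))
    · exact Or.inr (Or.inr (by rwa [← h, sub_sub_cancel]))
  · rintro (h | h | h)
    · exact ⟨_, h, Or.inl rfl⟩
    · exact ⟨_, h, Or.inr (Or.inl (by abel))⟩
    · exact ⟨_, h, Or.inr (Or.inr (by abel))⟩

lemma playable_cycleGraph {S : Finset (Fin (N + 2))} {v : Fin (N + 2)} :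
    Playable (cycleGraph (N + 2)) S v ↔
      ∃ u, (u = v ∨ u = v + 1 ∨ u + 1 = v) ∧ u ∉ S ∧ u + 1 ∉ S ∧ u - 1 ∉ S := by
  have hadj : ∀ u, (v - u = 1 ∨ u - v = 1) ↔ (u = v + 1 ∨ u + 1 = v) := by
    intro u
    rw [sub_eq_iff_eq_add', sub_eq_iff_eq_add', or_comm, eq_comm (a := v)]
  simp only [Playable, dominated_cycleGraph, cycleGraph_adj, hadj, not_or]

lemma four_le_gap_of_playable {S : Finset (Fin (N + 2))} {s : Fin (N + 2)} (hs : s ∈ S) {i : ℕ}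
    (hi : 0 < i) (hlt : i < gap S s) (hp : Playable (cycleGraph (N + 2)) S (s + i • 1)) :
    4 ≤ gap S s := by
  obtain ⟨u, hu, hu0, hu1, hu2⟩ := playable_cycleGraph.1 hp
  obtain ⟨j, rfl, hj, hjg⟩ : ∃ j : ℕ, u = s + j • 1 ∧ i ≤ j + 1 ∧ j ≤ i + 1 := by
    rcases hu with rfl | rfl | hu
    · exact ⟨i, rfl, by omega, by omega⟩
    · exact ⟨i + 1, by rw [add_nsmul, one_nsmul]; abel, by omega, by omega⟩
    · obtain ⟨k, rfl⟩ := Nat.exists_eq_succ_of_ne_zero hi.ne'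
      refine ⟨k, ?_, by omega, by omega⟩
      rw [succ_nsmul, ← add_assoc] at hu
      exact add_right_cancel hu
  have hend := (gap_spec hs).2
  have hj0 : j ≠ 0 := by
    rintro rfl
    exact hu0 (by simpa using hs)
  have hj1 : j ≠ 1 := by
    rintro rfl
    exact hu2 (by simpa using hs)
  have hjd : j ≠ gap S s := by
    rintro rfl
    exact hu0 hend
  have hjd1 : j + 1 ≠ gap S s := by
    intro h
    rw [← h, add_nsmul, one_nsmul, ← add_assoc] at hend
    exact hu1 hend
  omega

lemma playable_of_four_le_gap {S : Finset (Fin (N + 2))} {s : Fin (N + 2)} {i : ℕ}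
    (hi : 0 < i) (hlt : i < gap S s) (hd : 4 ≤ gap S s) :
    Playable (cycleGraph (N + 2)) S (s + i • 1) := by
  have hinner : ∀ j : ℕ, 0 < j → j + 2 < gap S s →
      s + (j + 1) • 1 ∉ S ∧ s + (j + 1) • 1 + 1 ∉ S ∧ s + (j + 1) • 1 - 1 ∉ S := by
    intro j hj hjd
    refine ⟨notMem_of_lt_gap (by omega) (by omega), ?_, ?_⟩
    · have h := notMem_of_lt_gap (S := S) (s := s) (j := j + 1 + 1) (by omega) (by omega)
      rwa [succ_nsmul _ (j + 1), ← add_assoc] at h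
    · have h := notMem_of_lt_gap (S := S) (s := s) hj (by omega)
      rwa [succ_nsmul, ← add_assoc, add_sub_cancel_right]
  rw [playable_cycleGraph]
  obtain ⟨j, rfl⟩ := Nat.exists_eq_succ_of_ne_zero hi.ne'
  by_cases h1 : j = 0
  · subst h1
    refine ⟨_, Or.inr (Or.inl ?_), hinner 1 (by omega) (by omega)⟩
    rw [succ_nsmul _ 1, ← add_assoc]
  by_cases h2 : j + 2 < gap S s
  · exact ⟨_, Or.inl rfl, hinner j (by omega) h2⟩
  · obtain ⟨k, rfl⟩ := Nat.exists_eq_succ_of_ne_zero h1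
    refine ⟨_, Or.inr (Or.inr ?_), hinner k (by omega) (by omega)⟩
    rw [succ_nsmul _ (k + 1), ← add_assoc]

lemma nimSum_gapValue_insert {S : Finset (Fin (N + 2))} {s : Fin (N + 2)} (hs : s ∈ S) {i : ℕ}
    (hi : 0 < i) (hlt : i < gap S s) :
    nimSum (insert (s + i • 1) S) (fun t => gapValue (gap (insert (s + i • 1) S) t)) =
      (gapValue i ^^^ gapValue (gap S s - i)) ^^^
        nimSum (S.erase s) (fun t => gapValue (gap S t)) := by
  rw [nimSum_insert (notMem_of_lt_gap hi hlt), nimSum_eq_xor_erase hs, gap_insert_self hs hlt,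
    gap_insert_left hs hi hlt, ← Nat.xor_assoc, Nat.xor_comm (gapValue i)]
  congr 1
  refine nimSum_congr fun t ht => ?_
  rw [gap_insert_of_ne hs (Finset.mem_of_mem_erase ht) (Finset.ne_of_mem_erase ht) hlt]

/-- A nonempty position on a cycle is the sum of the gaps between consecutive selected vertices. -/
theorem grundy_cycleGraph_eq_nimSum (S : Finset (Fin (N + 2))) (hS : S.Nonempty) :
    grundy (cycleGraph (N + 2)) S = nimSum S (fun t => gapValue (gap S t)) := by
  induction hc : (Finset.univ \ S).card using Nat.strong_induction_on generalizing S with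
  | _ c ih =>
  subst hc
  have key : ∀ v, Playable (cycleGraph (N + 2)) S v →
      grundy (cycleGraph (N + 2)) (insert v S) =
        nimSum (insert v S) (fun t => gapValue (gap (insert v S) t)) :=
    fun v hv => ih _ hv.card_lt _ (Finset.insert_nonempty v S) rfl
  refine grundy_eq_of_options (fun v hv heq => ?_) fun k hk => ?_
  · rw [key v hv] at heq
    obtain ⟨s, hs, i, hi, hlt, rfl⟩ := exists_mem_gap hS hv.not_mem
    rw [nimSum_gapValue_insert hs hi hlt, nimSum_eq_xor_erase hs] at heq
    have hd := four_le_gap_of_playable hs hi hlt hv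
    have hne := gapValue_xor_ne hi (Nat.sub_pos_of_lt hlt) (by omega)
    rw [Nat.add_sub_cancel' hlt.le] at hne
    exact hne (Nat.xor_left_injective heq)
  · obtain ⟨s, hs, hlt⟩ := exists_lt_of_lt_nimSum _ _ _ hk
    obtain ⟨i, hi, hid, hd, h⟩ := exists_split_of_lt_gapValue hlt
    have hp := playable_of_four_le_gap hi hid hd
    refine ⟨_, hp, ?_⟩
    rw [key _ hp, nimSum_gapValue_insert hs hi hid, h, Nat.xor_assoc, Nat.xor_self, Nat.xor_zero]

lemma gap_singleton (v : Fin (N + 2)) : gap {v} v = N + 2 := by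
  refine gap_eq (by omega) ?_ fun j hj hlt h => ?_
  · have h : (N + 2) • (1 : Fin (N + 2)) = 0 := by
      ext
      simp [val_nsmul_one]
    simp [h]
  · rw [Finset.mem_singleton, add_eq_left, Fin.ext_iff, val_nsmul_one,
      Nat.mod_eq_of_lt hlt] at h
    exact hj.ne' h

end Cycle

theorem grundy_cycle_one_selected (n : ℕ) (hn : 3 ≤ n) (v : Fin n) :
    grundy (SimpleGraph.cycleGraph n) {v} = (n - 3) % 4 := by
  obtain ⟨N, rfl⟩ := Nat.exists_eq_add_of_le' (show 2 ≤ n by omega)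
  rw [grundy_cycleGraph_eq_nimSum _ (Finset.singleton_nonempty v), nimSum,
    Finset.fold_singleton, gap_singleton, Nat.xor_zero, gapValue, if_neg (by omega)]
  omega
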